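/- There exists a constant c₂=c₂(K)>0 such that for all parameter pairs (φ,ψ) and (φ̃,ψ̃) in ∪_{δ,ε,ζ} Φ(δ,ε,ζ), one has ‖p^{(3)}_{φ,ψ} − p^{(3)}_{φ̃,ψ̃}‖ ≤ c₂·ρ((φ,ψ);(φ̃,ψ̃)), where ‖·‖ is the Euclidean norm on ℝ^{K×K×K} and p^{(3)}_{φ,ψ} denotes p^{(3)}_{θ(φ,ψ)}. -/

import Mathlib

open scoped BigOperators

namespace PaperHMM

/-- Parameter of a two-state HMM with multinomial emissions on `Fin K`. -/
structure Param (K : ℕ) where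
  p : ℝ
  q : ℝ
  f0 : Fin K → ℝ
  f1 : Fin K → ℝ

/-- `f` is a probability density with respect to counting measure on `Fin K`. -/
def IsDensity {K : ℕ} (f : Fin K → ℝ) : Prop :=
  (∀ k, 0 ≤ f k) ∧ ∑ k, f k = 1

/-- Validity of HMM parameters: `p, q ∈ (0,1)` and emission densities. -/
def Valid {K : ℕ} (θ : Param K) : Prop :=
  θ.p ∈ Set.Ioo (0 : ℝ) 1 ∧ θ.q ∈ Set.Ioo (0 : ℝ) 1 ∧
    IsDensity θ.f0 ∧ IsDensity θ.f1

/-- Euclidean norm of a finitely supported real function. -/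
noncomputable def enormF {α : Type*} [Fintype α] (g : α → ℝ) : ℝ :=
  Real.sqrt (∑ a, (g a) ^ 2)

/-- Stationary initial distribution of the hidden chain: `P(X₁=0)=q/(p+q)`. -/
noncomputable def initD {K : ℕ} (θ : Param K) : Fin 2 → ℝ :=
  fun a => if a = 0 then θ.q / (θ.p + θ.q) else θ.p / (θ.p + θ.q)

/-- Transition matrix `Q = [[1-p, p], [q, 1-q]]` of the hidden chain. -/
noncomputable def transP {K : ℕ} (θ : Param K) : Fin 2 → Fin 2 → ℝ :=
  fun a b =>
    if a = 0 then (if b = 0 then 1 - θ.p else θ.p)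
    else (if b = 0 then θ.q else 1 - θ.q)

/-- Emission densities indexed by the hidden state. -/
def emit {K : ℕ} (θ : Param K) : Fin 2 → Fin K → ℝ :=
  fun a => if a = 0 then θ.f0 else θ.f1

/-- The probability mass function `p_θ^{(n)}` of the first `n` observations
`(Y₁,…,Yₙ)`:  `∑_{x ∈ {0,1}ⁿ} P(X₁=x₁) ∏_{i<n} Q_{x_i,x_{i+1}} ∏_{i≤n} f_{x_i}(y_i)`. -/
noncomputable def pLaw {K : ℕ} (θ : Param K) (n : ℕ) (y : Fin n → Fin K) : ℝ :=
  ∑ x : Fin n → Fin 2,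
    (∏ i : Fin n,
        (if (i : ℕ) = 0 then initD θ (x i)
          else transP θ (x ⟨(i : ℕ) - 1, lt_of_le_of_lt (Nat.sub_le _ _) i.isLt⟩) (x i)))
      * ∏ i : Fin n, emit θ (x i) (y i)

open Classical in
/-- Probability under `P_θ` that `(Y₁,…,Yₙ)` lies in the event `E`. -/
noncomputable def probOf {K : ℕ} (θ : Param K) (n : ℕ)
    (E : (Fin n → Fin K) → Prop) : ℝ :=
  ∑ y : Fin n → Fin K, if E y then pLaw θ n y else 0

/-- The parameter class `Θ(δ,ε,ζ)`. -/
def ThetaSet (K : ℕ) (δ ε ζ : ℝ) : Set (Param K) :=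
  {θ | Valid θ ∧ δ ≤ θ.p ∧ δ ≤ θ.q ∧ ε ≤ |1 - θ.p - θ.q| ∧
    ζ ≤ enormF (fun k => θ.f0 k - θ.f1 k)}

/-- The parameter class `Θ_L(δ,ε,ζ)`. -/
def ThetaL (K : ℕ) (L δ ε ζ : ℝ) : Set (Param K) :=
  ThetaSet K δ ε ζ ∩ {θ | L ≤ 1 - |1 - θ.p - θ.q|}

/-- The reparametrised pair `(φ, ψ)`: scalar parameters `φ = (φ₁,φ₂,φ₃)` and
vector parameters `ψ = (ψ₁, ψ₂)`. -/
abbrev PP (K : ℕ) := (ℝ × ℝ × ℝ) × ((Fin K → ℝ) × (Fin K → ℝ))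

/-- `φ(θ) = ((q-p)/(p+q), 1-p-q, ‖f₀-f₁‖)`. -/
noncomputable def phiOf {K : ℕ} (θ : Param K) : ℝ × ℝ × ℝ :=
  ((θ.q - θ.p) / (θ.p + θ.q), 1 - θ.p - θ.q,
    enormF (fun k => θ.f0 k - θ.f1 k))

/-- `ψ(θ) = ((q f₀ + p f₁)/(p+q), (f₀-f₁)/‖f₀-f₁‖)`. -/
noncomputable def psiOf {K : ℕ} (θ : Param K) : (Fin K → ℝ) × (Fin K → ℝ) :=
  (fun k => (θ.q * θ.f0 k + θ.p * θ.f1 k) / (θ.p + θ.q),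
    fun k => (θ.f0 k - θ.f1 k) / enormF (fun j => θ.f0 j - θ.f1 j))

/-- The map `θ ↦ (φ(θ), ψ(θ))`. -/
noncomputable def pack {K : ℕ} (θ : Param K) : PP K := (phiOf θ, psiOf θ)

/-- The inverse parametrisation `θ(φ,ψ)`:
`p = ½(1-φ₂)(1-φ₁)`, `q = ½(1-φ₂)(1+φ₁)`,
`f₀ = ψ₁ - ½φ₁φ₃ψ₂ + ½φ₃ψ₂`, `f₁ = ψ₁ - ½φ₁φ₃ψ₂ - ½φ₃ψ₂`. -/
noncomputable def unpack {K : ℕ} (π : PP K) : Param K where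
  p := (1 - π.1.2.1) * (1 - π.1.1) / 2
  q := (1 - π.1.2.1) * (1 + π.1.1) / 2
  f0 := fun k => π.2.1 k - π.1.1 * π.1.2.2 * π.2.2 k / 2 + π.1.2.2 * π.2.2 k / 2
  f1 := fun k => π.2.1 k - π.1.1 * π.1.2.2 * π.2.2 k / 2 - π.1.2.2 * π.2.2 k / 2

/-- `Φ(δ,ε,ζ)`. -/
def PhiSet (K : ℕ) (δ ε ζ : ℝ) : Set (PP K) := pack '' ThetaSet K δ ε ζ

/-- `Φ_L(δ,ε,ζ)`. -/
def PhiL (K : ℕ) (L δ ε ζ : ℝ) : Set (PP K) := pack '' ThetaL K L δ ε ζ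

/-- `⋃_{δ,ε,ζ} Φ(δ,ε,ζ)`. -/
def PhiAll (K : ℕ) : Set (PP K) :=
  ⋃ (δ ∈ Set.Ioo (0 : ℝ) 1) (ε ∈ Set.Ioo (0 : ℝ) 1) (ζ ∈ Set.Ioi (0 : ℝ)),
    PhiSet K δ ε ζ

/-- `r(φ) = ¼ (1-φ₁²) φ₂ φ₃²`. -/
noncomputable def rfun (φ : ℝ × ℝ × ℝ) : ℝ :=
  (1 - φ.1 ^ 2) * φ.2.1 * φ.2.2 ^ 2 / 4

/-- `m(φ) = (r(φ), φ₂ r(φ), φ₁ φ₂ φ₃ r(φ))`. -/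
noncomputable def mvec (φ : ℝ × ℝ × ℝ) : ℝ × ℝ × ℝ :=
  (rfun φ, φ.2.1 * rfun φ, φ.1 * φ.2.1 * φ.2.2 * rfun φ)

/-- Sign function with the convention `sgn 0 = +1`. -/
noncomputable def sgn (t : ℝ) : ℝ := if t < 0 then -1 else 1

/-- The statistical distance `ρ((φ,ψ);(φ̃,ψ̃))`. -/
noncomputable def rho {K : ℕ} (π π' : PP K) : ℝ :=
  max (max (max (max
    |(mvec π.1).1 - (mvec π'.1).1|
    |(mvec π.1).2.1 - (mvec π'.1).2.1|)
    |(mvec π.1).2.2 - sgn (∑ k, π.2.2 k * π'.2.2 k) * (mvec π'.1).2.2|)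
    (enormF fun k => π.2.1 k - π'.2.1 k))
    ((max |(mvec π.1).1| |(mvec π'.1).1|) *
      enormF fun k => π.2.2 k - sgn (∑ j, π.2.2 j * π'.2.2 j) * π'.2.2 k)

/-- `p^{(3)}_{φ,ψ} = p^{(3)}_{θ(φ,ψ)}`, the law of three consecutive observations. -/
noncomputable def p3 {K : ℕ} (π : PP K) : (Fin 3 → Fin K) → ℝ :=
  pLaw (unpack π) 3

/-- The empirical estimator `p̂ₙ^{(3)}(a,b,c) = n⁻¹ ∑_{i=1}^{n-2} 1{Yᵢ=a, Y_{i+1}=b, Y_{i+2}=c}`. -/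
noncomputable def empP3 {K : ℕ} (n : ℕ) (y : Fin n → Fin K)
    (v : Fin 3 → Fin K) : ℝ :=
  (n : ℝ)⁻¹ * ∑ i : Fin n,
    if h : (i : ℕ) + 2 < n then
      (if y i = v 0 ∧ y ⟨(i : ℕ) + 1, by omega⟩ = v 1 ∧ y ⟨(i : ℕ) + 2, h⟩ = v 2
        then 1 else 0)
    else 0

/-- Kullback–Leibler divergence `K(P;Q) = ∑_y P(y) log(P(y)/Q(y))` between
probability mass functions on `(Fin K)ⁿ`. -/
noncomputable def klDiv {K : ℕ} (n : ℕ) (P Q : (Fin n → Fin K) → ℝ) : ℝ :=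
  ∑ y : Fin n → Fin K, P y * Real.log (P y / Q y)


theorem abs_le_enormF {α : Type*} [Fintype α] (g : α → ℝ) (a : α) : |g a| ≤ enormF g := by
  unfold enormF
  apply Real.abs_le_sqrt
  exact Finset.single_le_sum (f := fun a => g a ^ 2) (fun i _ => sq_nonneg _) (Finset.mem_univ a)

theorem tri_bound {m m' a b c a' b' c' A B C D : ℝ}
    (hb : |b| ≤ 1) (hc : |c| ≤ 1) (ha : |a| ≤ 1)
    (ha' : |a'| ≤ 1) (hb' : |b'| ≤ 1)
    (hm : |m - m'| ≤ A) (h1 : |m'| * |a - a'| ≤ B) (h2 : |m'| * |b - b'| ≤ C)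
    (h3 : |m'| * |c - c'| ≤ D) :
    |m * a * b * c - m' * a' * b' * c'| ≤ A + B + C + D := by
  have key : m * a * b * c - m' * a' * b' * c' =
      (m - m') * (a * b * c) + (m' * (a - a')) * (b * c) + (m' * (b - b')) * (a' * c)
        + (m' * (c - c')) * (a' * b') := by ring
  have aux : ∀ {x y z X : ℝ}, |x| ≤ X → |y| ≤ 1 → |z| ≤ 1 → |x * (y * z)| ≤ X := by
    intro x y z X hx hy hz
    rw [abs_mul, abs_mul]
    have := mul_le_one₀ hy (abs_nonneg z) hz
    have h0 := abs_nonneg x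
    have h00 := mul_le_mul hx this (by positivity) (h0.trans hx)
    linarith
  rw [← abs_mul] at h1 h2 h3
  have hab : |a * b| ≤ 1 := by rw [abs_mul]; exact mul_le_one₀ ha (abs_nonneg _) hb
  have e1 := aux hm hab hc
  have e2 := aux h1 hb hc
  have e3 := aux h2 ha' hc
  have e4 := aux h3 ha' hb'
  rw [key]
  refine (abs_add_le _ _).trans (add_le_add ((abs_add_le _ _).trans (add_le_add
    ((abs_add_le _ _).trans (add_le_add e1 e2)) e3)) e4)

/-- Explicit tensor form of the law of three observations. -/
theorem p3_eq {K : ℕ} (π : PP K) (h : π.1.2.1 ≠ 1) (v : Fin 3 → Fin K) :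
    p3 π v = 1 * π.2.1 (v 0) * π.2.1 (v 1) * π.2.1 (v 2)
      + (mvec π.1).1 * π.2.2 (v 0) * π.2.2 (v 1) * π.2.1 (v 2)
      + (mvec π.1).1 * π.2.1 (v 0) * π.2.2 (v 1) * π.2.2 (v 2)
      + (mvec π.1).2.1 * π.2.2 (v 0) * π.2.1 (v 1) * π.2.2 (v 2)
      - (mvec π.1).2.2 * π.2.2 (v 0) * π.2.2 (v 1) * π.2.2 (v 2) := by
  obtain ⟨⟨f1, f2, f3⟩, w, u⟩ := π
  have h' : 1 - f2 ≠ 0 := fun e => h (by simp only; linarith)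
  have hs : ∀ F : (Fin 3 → Fin 2) → ℝ, ∑ x, F x =
      ∑ a : Fin 2, ∑ b : Fin 2, ∑ c : Fin 2, F ![a, b, c] := by
    intro F
    rw [← (Fin.consEquiv (fun _ : Fin 3 => Fin 2)).sum_comp, Fintype.sum_prod_type]
    refine Finset.sum_congr rfl fun a _ => ?_
    rw [← (Fin.consEquiv (fun _ : Fin 2 => Fin 2)).sum_comp, Fintype.sum_prod_type]
    refine Finset.sum_congr rfl fun b _ => ?_
    rw [← (Fin.consEquiv (fun _ : Fin 1 => Fin 2)).sum_comp, Fintype.sum_prod_type]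
    refine Finset.sum_congr rfl fun c _ => ?_
    rw [Fintype.sum_unique]
    congr 1
  have hq : (1 - f2) * (1 + f1) / 2 / ((1 - f2) * (1 - f1) / 2 + (1 - f2) * (1 + f1) / 2)
      = (1 + f1) / 2 := by
    rw [show (1 - f2) * (1 - f1) / 2 + (1 - f2) * (1 + f1) / 2 = 1 - f2 by ring]
    field_simp
  have hp : (1 - f2) * (1 - f1) / 2 / ((1 - f2) * (1 - f1) / 2 + (1 - f2) * (1 + f1) / 2)
      = (1 - f1) / 2 := by
    rw [show (1 - f2) * (1 - f1) / 2 + (1 - f2) * (1 + f1) / 2 = 1 - f2 by ring]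
    field_simp
  unfold p3 pLaw
  rw [hs]
  simp only [Fin.sum_univ_two, Fin.prod_univ_three]
  simp [initD, transP, emit, unpack, mvec, rfun, hq, hp]
  ring

theorem mem_facts {K : ℕ} {π : PP K} (h : π ∈ PhiAll K) :
    π.1.2.1 ≠ 1 ∧ (∀ k, |π.2.1 k| ≤ 1) ∧ (∀ k, |π.2.2 k| ≤ 1) ∧ |(mvec π.1).1| ≤ 1 ∧
      |(mvec π.1).2.1| ≤ |(mvec π.1).1| ∧ |(mvec π.1).2.2| ≤ 2 * |(mvec π.1).1| := by
  simp only [PhiAll, Set.mem_iUnion] at h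
  obtain ⟨δ, hδ, ε, hε, ζ, hζ, θ, ⟨⟨hp, hq, h0, h1⟩, -, -, -, hz⟩, rfl⟩ := h
  obtain ⟨p0, p1⟩ := hp
  obtain ⟨q0, q1⟩ := hq
  have le1 : ∀ {f : Fin K → ℝ}, IsDensity f → ∀ k, f k ≤ 1 := by
    intro f hf k
    rw [← hf.2]
    exact Finset.single_le_sum (fun i _ => hf.1 i) (Finset.mem_univ k)
  have hpq : 0 < θ.p + θ.q := by linarith
  set N := enormF (fun k => θ.f0 k - θ.f1 k) with hN
  have hNpos : 0 < N := lt_of_lt_of_le hζ hz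
  have hN2 : N ≤ 2 := by
    rw [hN, enormF, Real.sqrt_le_left (by norm_num)]
    calc ∑ k, (θ.f0 k - θ.f1 k) ^ 2 ≤ ∑ k, (θ.f0 k + θ.f1 k) := by
          refine Finset.sum_le_sum fun k _ => ?_
          nlinarith [h0.1 k, h1.1 k, le1 h0 k, le1 h1 k, mul_nonneg (h0.1 k) (h1.1 k)]
      _ = 2 := by rw [Finset.sum_add_distrib, h0.2, h1.2]; norm_num
      _ ≤ 2 ^ 2 := by norm_num
  have hf1 : |(θ.q - θ.p) / (θ.p + θ.q)| ≤ 1 := by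
    rw [abs_div, abs_of_pos hpq, div_le_one hpq, abs_le]
    constructor <;> linarith
  have hf2 : |1 - θ.p - θ.q| ≤ 1 := by
    rw [abs_le]
    constructor <;> linarith
  have hr : |rfun (phiOf θ)| ≤ 1 := by
    unfold rfun phiOf
    simp only
    rw [← hN]
    rw [abs_div, abs_mul, abs_mul]
    have a1 : |1 - ((θ.q - θ.p) / (θ.p + θ.q)) ^ 2| ≤ 1 := by
      have := (sq_le_one_iff_abs_le_one _).2 hf1
      rw [abs_le]
      constructor <;> nlinarith [sq_nonneg ((θ.q - θ.p) / (θ.p + θ.q))]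
    have a2 := mul_le_one₀ a1 (abs_nonneg _) hf2
    have a3 : |N ^ 2| ≤ 4 := by
      rw [abs_of_nonneg (sq_nonneg _)]
      nlinarith
    have a4 := mul_le_mul a2 a3 (abs_nonneg _) zero_le_one
    rw [abs_of_pos (by norm_num : (0:ℝ) < 4), div_le_one (by norm_num)]
    linarith
  refine ⟨?_, ?_, ?_, hr, ?_, ?_⟩
  · simp only [pack, phiOf]
    intro e
    linarith
  · intro k
    simp only [pack, psiOf]
    rw [abs_div, abs_of_pos hpq, div_le_one hpq, abs_le]
    have := mul_nonneg q0.le (h0.1 k)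
    have := mul_nonneg p0.le (h1.1 k)
    have := mul_le_mul_of_nonneg_left (le1 h0 k) q0.le
    have := mul_le_mul_of_nonneg_left (le1 h1 k) p0.le
    constructor <;> linarith
  · intro k
    simp only [pack, psiOf]
    rw [← hN, abs_div, abs_of_pos hNpos, div_le_one hNpos, hN]
    exact abs_le_enormF (fun k => θ.f0 k - θ.f1 k) k
  · simp only [pack, mvec]
    rw [abs_mul]
    exact mul_le_of_le_one_left (abs_nonneg _) hf2
  · simp only [pack, mvec]
    rw [abs_mul]
    refine mul_le_mul_of_nonneg_right ?_ (abs_nonneg _)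
    simp only [phiOf]
    rw [← hN, abs_mul, abs_mul, abs_of_pos hNpos]
    have a2 := mul_le_one₀ hf1 (abs_nonneg _) hf2
    have a4 := mul_le_mul a2 hN2 hNpos.le zero_le_one
    linarith

theorem pointwise {K : ℕ} {π π' : PP K} (h : π ∈ PhiAll K) (h' : π' ∈ PhiAll K)
    (v : Fin 3 → Fin K) : |p3 π v - p3 π' v| ≤ 22 * rho π π' := by
  obtain ⟨n1, w1, u1, r1, -, -⟩ := mem_facts h
  obtain ⟨n1', w1', u1', r1', r2', r3'⟩ := mem_facts h'
  rw [p3_eq π n1, p3_eq π' n1']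
  have g1 : |(mvec π.1).1 - (mvec π'.1).1| ≤ rho π π' := by simp [rho]
  have g2 : |(mvec π.1).2.1 - (mvec π'.1).2.1| ≤ rho π π' := by simp [rho]
  have g3 : |(mvec π.1).2.2 - sgn (∑ k, π.2.2 k * π'.2.2 k) * (mvec π'.1).2.2| ≤ rho π π' := by
    simp [rho]
  have g4 : (enormF fun k => π.2.1 k - π'.2.1 k) ≤ rho π π' := by simp [rho]
  have g5 : (max |(mvec π.1).1| |(mvec π'.1).1|) *
      (enormF fun k => π.2.2 k - sgn (∑ j, π.2.2 j * π'.2.2 j) * π'.2.2 k) ≤ rho π π' :=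
    le_max_right _ _
  have hs : sgn (∑ k, π.2.2 k * π'.2.2 k) = 1 ∨ sgn (∑ k, π.2.2 k * π'.2.2 k) = -1 := by
    unfold sgn
    split_ifs <;> simp
  generalize rho π π' = R at *
  generalize sgn (∑ k, π.2.2 k * π'.2.2 k) = s at *
  have hR : 0 ≤ R := (abs_nonneg _).trans g1
  have hss : s * s = 1 := by rcases hs with rfl | rfl <;> norm_num
  have hsa : |s| = 1 := by rcases hs with rfl | rfl <;> norm_num
  have hw : ∀ k, |π.2.1 k - π'.2.1 k| ≤ R := fun k =>
    (abs_le_enormF (fun k => π.2.1 k - π'.2.1 k) k).trans g4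
  have hu : ∀ k, |(mvec π'.1).1| * |π.2.2 k - s * π'.2.2 k| ≤ R := fun k =>
    (mul_le_mul (le_max_right _ _) (abs_le_enormF (fun k => π.2.2 k - s * π'.2.2 k) k)
      (abs_nonneg _) ((abs_nonneg _).trans (le_max_left _ _))).trans g5
  have ht : ∀ k, |s * π'.2.2 k| ≤ 1 := fun k => by rw [abs_mul, hsa, one_mul]; exact u1' k
  have hw1 : ∀ k, |(1:ℝ)| * |π.2.1 k - π'.2.1 k| ≤ R := fun k => by simpa using hw k
  have hw2 : ∀ k, |(mvec π'.1).1| * |π.2.1 k - π'.2.1 k| ≤ R := fun k =>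
    (mul_le_of_le_one_left (abs_nonneg _) r1').trans (hw k)
  have hw3 : ∀ k, |(mvec π'.1).2.1| * |π.2.1 k - π'.2.1 k| ≤ R := fun k =>
    (mul_le_of_le_one_left (abs_nonneg _) (r2'.trans r1')).trans (hw k)
  have hu2 : ∀ k, |(mvec π'.1).2.1| * |π.2.2 k - s * π'.2.2 k| ≤ R := fun k =>
    (mul_le_mul_of_nonneg_right r2' (abs_nonneg _)).trans (hu k)
  have hu3 : ∀ k, |s * (mvec π'.1).2.2| * |π.2.2 k - s * π'.2.2 k| ≤ 2 * R := fun k => by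
    rw [abs_mul, hsa, one_mul]
    have := mul_le_mul_of_nonneg_right r3' (abs_nonneg (π.2.2 k - s * π'.2.2 k))
    linarith [hu k]
  have t0 := tri_bound (m := 1) (m' := 1) (w1 (v 1)) (w1 (v 2)) (w1 (v 0)) (w1' (v 0)) (w1' (v 1))
    (by simp : |(1:ℝ) - 1| ≤ 0) (hw1 (v 0)) (hw1 (v 1)) (hw1 (v 2))
  have t1 := tri_bound (u1 (v 1)) (w1 (v 2)) (u1 (v 0)) (ht (v 0)) (ht (v 1))
    g1 (hu (v 0)) (hu (v 1)) (hw2 (v 2))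
  have t2 := tri_bound (u1 (v 1)) (u1 (v 2)) (w1 (v 0)) (w1' (v 0)) (ht (v 1))
    g1 (hw2 (v 0)) (hu (v 1)) (hu (v 2))
  have t3 := tri_bound (w1 (v 1)) (u1 (v 2)) (u1 (v 0)) (ht (v 0)) (w1' (v 1))
    g2 (hu2 (v 0)) (hw3 (v 1)) (hu2 (v 2))
  have t4 := tri_bound (u1 (v 1)) (u1 (v 2)) (u1 (v 0)) (ht (v 0)) (ht (v 1))
    g3 (hu3 (v 0)) (hu3 (v 1)) (hu3 (v 2))
  have e1 : ∀ m a b c : ℝ, m * (s * a) * (s * b) * c = m * a * b * c := fun m a b c => by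
    linear_combination (m * a * b * c) * hss
  have e2 : ∀ m a b c : ℝ, m * a * (s * b) * (s * c) = m * a * b * c := fun m a b c => by
    linear_combination (m * a * b * c) * hss
  have e3 : ∀ m a b c : ℝ, m * (s * a) * b * (s * c) = m * a * b * c := fun m a b c => by
    linear_combination (m * a * b * c) * hss
  have e4 : ∀ m a b c : ℝ, (s * m) * (s * a) * (s * b) * (s * c) = m * a * b * c :=
    fun m a b c => by
      linear_combination (m * a * b * c) * (s * s + 1) * hss
  rw [e4] at t4
  rw [e1] at t1
  rw [e2] at t2
  rw [e3] at t3
  rw [abs_le] at t0 t1 t2 t3 t4 ⊢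
  constructor <;> linarith [t0.1, t0.2, t1.1, t1.2, t2.1, t2.2, t3.1, t3.2, t4.1, t4.2]

theorem statement6 (K : ℕ) (hK : 2 ≤ K) :
    ∃ c₂ : ℝ, 0 < c₂ ∧
      ∀ π ∈ PhiAll K, ∀ π' ∈ PhiAll K,
        enormF (fun v => p3 π v - p3 π' v) ≤ c₂ * rho π π' := by
  refine ⟨22 * Real.sqrt (Fintype.card (Fin 3 → Fin K)) + 1, by positivity, ?_⟩
  intro π h π' h'
  have hR : 0 ≤ rho π π' := (abs_nonneg ((mvec π.1).1 - (mvec π'.1).1)).trans (by simp [rho])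
  have h1 : enormF (fun v => p3 π v - p3 π' v) ≤
      Real.sqrt (Fintype.card (Fin 3 → Fin K)) * (22 * rho π π') := by
    unfold enormF
    rw [← Real.sqrt_sq (by positivity : 0 ≤ 22 * rho π π'), ← Real.sqrt_mul (by positivity)]
    apply Real.sqrt_le_sqrt
    have := Finset.sum_le_card_nsmul Finset.univ (fun v => (p3 π v - p3 π' v) ^ 2)
      ((22 * rho π π') ^ 2) (fun v _ => sq_le_sq' (by linarith [(abs_le.1 (pointwise h h' v)).1])
        (abs_le.1 (pointwise h h' v)).2)
    rw [nsmul_eq_mul, Finset.card_univ] at this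
    exact this
  linarith

end PaperHMM
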